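/- arXiv:2510.05628 — 2 statements merged into one kernel-verified Lean document; each statement's English description precedes it below -/
import Mathlib

section
/- Let X be a nonempty finite set of points of ℙ¹×ℙ¹, let {A₁,…,A_h} be the set of first coordinates of points of X and {B₁,…,B_v} the set of second coordinates. Then there exists a finite set G of nonzero bihomogeneous polynomials minimally generating I_X such that the two products f = H_{A₁}⋯H_{A_h} and g = V_{B₁}⋯V_{B_v} both belong to G, and Ideal.span {f, g} = I_W where W = {Aᵢ×Bⱼ : 1 ≤ i ≤ h, 1 ≤ j ≤ v} is the grid of points; in particular I_X admits a point splitting. -/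
/- Common setup: R = ℂ[x₀,x₁,y₀,y₁] as MvPolynomial (Fin 4) ℂ with
   x₀ = X 0, x₁ = X 1, y₀ = X 2, y₁ = X 3.
   `Hf a` is the horizontal form a₁x₀ - a₀x₁ of the point a = [a₀:a₁] ∈ ℙ¹;
   `Vf b` is the vertical form b₁y₀ - b₀y₁;
   `cross a b ≠ 0` says the (nonzero) pairs a, b are non-proportional,
   i.e. define distinct points of ℙ¹. -/

open MvPolynomial

noncomputable section

abbrev R : Type := MvPolynomial (Fin 4) ℂ

def Hf (a : ℂ × ℂ) : R := C a.2 * X 0 - C a.1 * X 1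

def Vf (b : ℂ × ℂ) : R := C b.2 * X 2 - C b.1 * X 3

def cross (a b : ℂ × ℂ) : ℂ := a.1 * b.2 - a.2 * b.1

/-- The defining ideal of the point P = A×B of ℙ¹×ℙ¹. -/
def Ipt (P : (ℂ × ℂ) × (ℂ × ℂ)) : Ideal R := Ideal.span {Hf P.1, Vf P.2}

/-- The defining ideal of a finite set of points (I_∅ = R = ⊤). -/
def Ipts (X : Finset ((ℂ × ℂ) × (ℂ × ℂ))) : Ideal R := X.inf Ipt

/-- The defining ideal of a set of points (I_∅ = R = ⊤). -/
def IptsSet (W : Set ((ℂ × ℂ) × (ℂ × ℂ))) : Ideal R := ⨅ P ∈ W, Ipt P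

/-- Bihomogeneous: homogeneous separately in x₀,x₁ and in y₀,y₁. -/
def Bihom (f : R) : Prop :=
  ∃ a b : ℕ, IsWeightedHomogeneous (![1,1,0,0] : Fin 4 → ℕ) f a ∧
    IsWeightedHomogeneous (![0,0,1,1] : Fin 4 → ℕ) f b

/-- `G` minimally generates `I`. -/
def MinGen (G : Finset R) (I : Ideal R) : Prop :=
  Ideal.span (G : Set R) = I ∧ ∀ g ∈ G, Ideal.span ((G : Set R) \ {g}) ≠ I


/-- General linear form in two of the variables. -/
def Lf (i j : Fin 4) (a : ℂ × ℂ) : R := C a.2 * X i - C a.1 * X j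

theorem Hf_eq (a : ℂ × ℂ) : Hf a = Lf 0 1 a := rfl
theorem Vf_eq (a : ℂ × ℂ) : Vf a = Lf 2 3 a := rfl

/-- Set two of the variables to zero. -/
def kill (i j : Fin 4) : R →ₐ[ℂ] R := aeval (fun k => if k = i ∨ k = j then 0 else X k)

theorem kill_sub_mem (i j : Fin 4) (p : R) :
    p - kill i j p ∈ Ideal.span ({X i, X j} : Set R) := by
  induction p using MvPolynomial.induction_on with
  | C a => simp [kill]
  | add p q hp hq =>
    have : p + q - kill i j (p + q) = (p - kill i j p) + (q - kill i j q) := by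
      rw [map_add]; ring
    rw [this]; exact Ideal.add_mem _ hp hq
  | mul_X p k hp =>
    by_cases hk : k = i ∨ k = j
    · have h1 : kill i j (X k) = 0 := by simp [kill, hk]
      rw [map_mul, h1, mul_zero, sub_zero]
      apply Ideal.mul_mem_left
      apply Ideal.subset_span
      rcases hk with rfl | rfl <;> simp
    · have h1 : kill i j (X k) = X k := by simp [kill, hk]
      rw [map_mul, h1, ← sub_mul]
      exact Ideal.mul_mem_right _ _ hp

theorem mem_span_X_iff (i j : Fin 4) (p : R) :
    p ∈ Ideal.span ({X i, X j} : Set R) ↔ kill i j p = 0 := by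
  constructor
  · intro h
    obtain ⟨a, b, rfl⟩ := Ideal.mem_span_pair.1 h
    simp [kill]
  · intro h
    have := kill_sub_mem i j p
    rwa [h, sub_zero] at this

theorem Lf_eval (i j : Fin 4) (a : ℂ × ℂ) (z : Fin 4 → ℂ) :
    eval z (Lf i j a) = a.2 * z i - a.1 * z j := by simp [Lf]

theorem Lf_ne {i j : Fin 4} (hij : i ≠ j) {a : ℂ × ℂ} (ha : a ≠ 0) : Lf i j a ≠ 0 := by
  intro h
  apply ha
  have h1 := Lf_eval i j a (fun k => if k = i then 1 else 0)
  have h2 := Lf_eval i j a (fun k => if k = j then 1 else 0)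
  rw [h] at h1 h2
  simp [hij.symm] at h1
  simp [hij] at h2
  exact Prod.ext h2 h1.symm

theorem Lf_prime {i j : Fin 4} (hij : i ≠ j) {a : ℂ × ℂ} (ha : a ≠ 0) : Prime (Lf i j a) := by
  rw [← irreducible_iff_prime]
  have hne := Lf_ne hij ha
  apply irreducible_of_totalDegree_eq_one
  · have : (Lf i j a).IsHomogeneous 1 := by
      unfold Lf
      exact ((isHomogeneous_X _ _).C_mul _).sub ((isHomogeneous_X _ _).C_mul _)
    exact this.totalDegree hne
  · intro x hx
    rw [isUnit_iff_ne_zero]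
    rintro rfl
    apply hne
    ext m
    simpa using hx m

theorem Lf_not_dvd {i j : Fin 4} (hij : i ≠ j) {a b : ℂ × ℂ} (h : cross a b ≠ 0) :
    ¬ Lf i j a ∣ Lf i j b := by
  rintro ⟨q, hq⟩
  apply h
  have := congrArg (eval (fun k => if k = i then a.1 else a.2)) hq
  rw [map_mul, Lf_eval, Lf_eval] at this
  simp [hij.symm] at this
  unfold cross
  linear_combination this

theorem span_Lf {i j : Fin 4} {a b : ℂ × ℂ} (h : cross a b ≠ 0) :
    Ideal.span ({Lf i j a, Lf i j b} : Set R) = Ideal.span {X i, X j} := by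
  apply le_antisymm
  · rw [Ideal.span_le]
    rintro _ (rfl | rfl)
    · exact Ideal.mem_span_pair.2 ⟨C a.2, - C a.1, by simp [Lf]; ring⟩
    · exact Ideal.mem_span_pair.2 ⟨C b.2, - C b.1, by simp [Lf]; ring⟩
  · have hc : (C (cross a b)⁻¹ : R) * (C a.1 * C b.2 - C a.2 * C b.1) = 1 := by
      rw [← C_mul, ← C_mul, ← C_sub, ← C_mul]
      change C ((cross a b)⁻¹ * cross a b) = 1
      rw [inv_mul_cancel₀ h, C_1]
    rw [Ideal.span_le]
    rintro _ (rfl | rfl)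
    · exact Ideal.mem_span_pair.2 ⟨- C (cross a b)⁻¹ * C b.1, C (cross a b)⁻¹ * C a.1, by
        unfold Lf; linear_combination (X i) * hc⟩
    · exact Ideal.mem_span_pair.2 ⟨- C (cross a b)⁻¹ * C b.2, C (cross a b)⁻¹ * C a.2, by
        unfold Lf; linear_combination (X j) * hc⟩

theorem colon_one {i j : Fin 4} (hij : i ≠ j) {a b : ℂ × ℂ} (h : cross a b ≠ 0) (hb : b ≠ 0)
    {g q : R} (hg : kill i j g ≠ 0)
    (hq : Lf i j a * q ∈ Ideal.span ({Lf i j b, g} : Set R)) :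
    q ∈ Ideal.span ({Lf i j b, g} : Set R) := by
  obtain ⟨s, t, hst⟩ := Ideal.mem_span_pair.1 hq
  have hba : cross b a ≠ 0 := by
    intro h'; apply h; unfold cross at *; linear_combination -h'
  have h1 : t * g ∈ Ideal.span ({X i, X j} : Set R) := by
    rw [← span_Lf h]
    exact Ideal.mem_span_pair.2 ⟨q, -s, by linear_combination -hst⟩
  rw [mem_span_X_iff, map_mul, mul_eq_zero] at h1
  have h2 := (mem_span_X_iff i j t).2 (h1.resolve_right hg)
  rw [← span_Lf h] at h2
  obtain ⟨α, β, hαβ⟩ := Ideal.mem_span_pair.1 h2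
  have h3 : Lf i j b ∣ Lf i j a * (q - g * α) :=
    ⟨s + g * β, by linear_combination -hst - g * hαβ⟩
  obtain ⟨r, hr⟩ := ((Lf_prime hij hb).dvd_or_dvd h3).resolve_left (Lf_not_dvd hij hba)
  exact Ideal.mem_span_pair.2 ⟨r, α, by linear_combination -hr⟩

theorem colon_prod {i j : Fin 4} (hij : i ≠ j) (s : Finset (ℂ × ℂ)) {b : ℂ × ℂ}
    (hs : ∀ a ∈ s, cross a b ≠ 0) (hb : b ≠ 0) {g q : R} (hg : kill i j g ≠ 0)
    (hq : (∏ a ∈ s, Lf i j a) * q ∈ Ideal.span ({Lf i j b, g} : Set R)) :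
    q ∈ Ideal.span ({Lf i j b, g} : Set R) := by
  induction s using Finset.induction_on with
  | empty => simpa using hq
  | insert c s hc ih =>
    rw [Finset.prod_insert hc, mul_assoc] at hq
    exact ih (fun a ha => hs a (Finset.mem_insert_of_mem ha))
      (colon_one hij (hs c (Finset.mem_insert_self _ _)) hb hg hq)

theorem inter_prod {i j : Fin 4} (hij : i ≠ j) (s : Finset (ℂ × ℂ)) (hs0 : ∀ a ∈ s, a ≠ 0)
    (hs : ∀ a ∈ s, ∀ b ∈ s, cross a b = 0 → a = b) {g p : R} (hg : kill i j g ≠ 0)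
    (hp : ∀ a ∈ s, p ∈ Ideal.span ({Lf i j a, g} : Set R)) :
    p ∈ Ideal.span ({∏ a ∈ s, Lf i j a, g} : Set R) := by
  induction s using Finset.induction_on with
  | empty => 
    exact Ideal.mem_span_pair.2 ⟨p, 0, by simp⟩
  | insert c s hc ih =>
    have h1 := ih (fun a ha => hs0 a (Finset.mem_insert_of_mem ha))
      (fun a ha b hb => hs a (Finset.mem_insert_of_mem ha) b (Finset.mem_insert_of_mem hb))
      (fun a ha => hp a (Finset.mem_insert_of_mem ha))
    have h2 := hp c (Finset.mem_insert_self _ _)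
    obtain ⟨q, r, hqr⟩ := Ideal.mem_span_pair.1 h1
    obtain ⟨q', r', hqr'⟩ := Ideal.mem_span_pair.1 h2
    have h3 : q ∈ Ideal.span ({Lf i j c, g} : Set R) := by
      apply colon_prod hij s (b := c) _ (hs0 c (Finset.mem_insert_self _ _)) hg
      · exact Ideal.mem_span_pair.2 ⟨q', r' - r, by linear_combination hqr' - hqr⟩
      · intro a ha h
        have := hs a (Finset.mem_insert_of_mem ha) c (Finset.mem_insert_self _ _) h
        exact hc (this ▸ ha)
    obtain ⟨u, v, huv⟩ := Ideal.mem_span_pair.1 h3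
    rw [Finset.prod_insert hc]
    exact Ideal.mem_span_pair.2 ⟨u, r + v * ∏ a ∈ s, Lf i j a, by
      linear_combination hqr + (∏ a ∈ s, Lf i j a) * huv⟩

theorem prod_dvd {i j : Fin 4} (hij : i ≠ j) (s : Finset (ℂ × ℂ)) (hs0 : ∀ a ∈ s, a ≠ 0)
    (hs : ∀ a ∈ s, ∀ b ∈ s, cross a b = 0 → a = b) {p : R}
    (hp : ∀ a ∈ s, Lf i j a ∣ p) : ∏ a ∈ s, Lf i j a ∣ p := by
  apply Finset.prod_dvd_of_isRelPrime _ hp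
  intro a ha b hb hab
  exact ((Lf_prime hij (hs0 a ha)).irreducible.isRelPrime_iff_not_dvd).2
    (Lf_not_dvd hij (fun h => hab (hs a ha b hb h)))

theorem kill_Lf_self (i j : Fin 4) (a : ℂ × ℂ) : kill i j (Lf i j a) = 0 := by
  simp [kill, Lf]

theorem kill_Lf_other {i j k l : Fin 4} (h1 : k ≠ i) (h2 : k ≠ j) (h3 : l ≠ i) (h4 : l ≠ j)
    (a : ℂ × ℂ) : kill i j (Lf k l a) = Lf k l a := by
  simp [kill, Lf, h1, h2, h3, h4]

theorem kill_of_hom {i j : Fin 4} {w : Fin 4 → ℕ} (hi : w i = 1) (hj : w j = 1) 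
    (hk : ∀ k, k ≠ i → k ≠ j → w k = 0)
    {p : R} {n : ℕ} (hp : IsWeightedHomogeneous w p n) : kill i j p = 0 ∨ kill i j p = p := by
  have key : ∀ m ∈ p.support, kill i j (monomial m (coeff m p)) =
      if n = 0 then monomial m (coeff m p) else 0 := by
    intro m hm
    have hw := hp (mem_support_iff.1 hm)
    rw [Finsupp.weight_apply, Finsupp.sum_fintype _ _ (by simp)] at hw
    simp only [kill, aeval_monomial]
    split_ifs with hn
    · subst hn
      rw [Finset.sum_eq_zero_iff] at hw
      rw [monomial_eq]
      congr 1
      apply Finsupp.prod_congr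
      intro k hk'
      rw [if_neg]
      rintro h
      have h1 := hw k (Finset.mem_univ _)
      rw [Finsupp.mem_support_iff] at hk'
      rcases h with rfl | rfl <;> simp_all
    · have : ∃ k, (k = i ∨ k = j) ∧ m k ≠ 0 := by
        by_contra hcon
        push Not at hcon
        apply hn
        rw [← hw]
        apply Finset.sum_eq_zero
        intro k _
        by_cases h : k = i ∨ k = j
        · simp [hcon k h]
        · push Not at h
          simp [hk k h.1 h.2]
      obtain ⟨k, hk1, hk2⟩ := this
      rw [Finsupp.prod, Finset.prod_eq_zero (Finsupp.mem_support_iff.2 hk2), mul_zero]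
      rw [if_pos hk1, zero_pow hk2]
  have hsum : kill i j p = ∑ m ∈ p.support, if n = 0 then monomial m (coeff m p) else 0 := by
    conv_lhs => rw [p.as_sum, map_sum]
    exact Finset.sum_congr rfl key
  by_cases hn : n = 0
  · right; rw [hsum]; simp only [hn, if_true]; exact p.as_sum.symm
  · left; rw [hsum]; simp [hn]

/-- Bigrading weight. -/
def bw : Fin 4 → ℕ × ℕ := ![(1,0),(1,0),(0,1),(0,1)]

theorem bihom_of_bw {p : R} {d : ℕ × ℕ} (h : IsWeightedHomogeneous bw p d) : Bihom p := by
  refine ⟨d.1, d.2, ?_, ?_⟩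
  · intro m hm
    rw [← h hm]
    simp [Finsupp.weight_apply, Finsupp.sum_fintype, Fin.sum_univ_four, bw]
  · intro m hm
    rw [← h hm]
    simp [Finsupp.weight_apply, Finsupp.sum_fintype, Fin.sum_univ_four, bw]

theorem hom_Hf (a : ℂ × ℂ) : IsWeightedHomogeneous bw (Hf a) (1, 0) := by
  have h0 := (isWeightedHomogeneous_X ℂ bw (0 : Fin 4)).C_mul a.2
  have h1 := (isWeightedHomogeneous_X ℂ bw (1 : Fin 4)).C_mul a.1
  exact Submodule.sub_mem (weightedHomogeneousSubmodule ℂ bw (1, 0)) h0 h1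

theorem hom_Vf (a : ℂ × ℂ) : IsWeightedHomogeneous bw (Vf a) (0, 1) := by
  have h0 := (isWeightedHomogeneous_X ℂ bw (2 : Fin 4)).C_mul a.2
  have h1 := (isWeightedHomogeneous_X ℂ bw (3 : Fin 4)).C_mul a.1
  exact Submodule.sub_mem (weightedHomogeneousSubmodule ℂ bw (0, 1)) h0 h1

theorem exists_hom_gens (Y : Finset ((ℂ × ℂ) × (ℂ × ℂ))) :
    ∃ S : Finset R, (∀ p ∈ S, p ≠ 0 ∧ Bihom p) ∧ Ideal.span (S : Set R) = Ipts Y := by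
  classical
  letI := weightedGradedAlgebra ℂ bw
  have hI : (Ipts Y).IsHomogeneous (weightedHomogeneousSubmodule ℂ bw) := by
    unfold Ipts
    induction Y using Finset.induction_on with
    | empty => simpa using Ideal.IsHomogeneous.top _
    | insert a s _ ih =>
      rw [Finset.inf_insert]
      refine Ideal.IsHomogeneous.inf (Ideal.homogeneous_span _ _ ?_) ih
      rintro _ (rfl | rfl)
      · exact ⟨(1, 0), hom_Hf _⟩
      · exact ⟨(0, 1), hom_Vf _⟩
  obtain ⟨S, hS⟩ := (Ideal.IsHomogeneous.iff_exists _ _).1 hI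
  have hfg : (Submodule.span R ((↑) '' S : Set R)).FG := IsNoetherian.noetherian _
  rw [Submodule.fg_span_iff_fg_span_finset_subset] at hfg
  obtain ⟨T, hT, hT2⟩ := hfg
  refine ⟨T.erase 0, ?_, ?_⟩
  · intro p hp
    rw [Finset.mem_erase] at hp
    refine ⟨hp.1, ?_⟩
    obtain ⟨q, _, rfl⟩ := hT hp.2
    obtain ⟨d, hd⟩ := q.2
    exact bihom_of_bw hd
  · rw [hS, Finset.coe_erase]
    exact (Ideal.span_sdiff_singleton_zero).trans hT2.symm

/-- Removing the distinguished generator from an otherwise irredundant set loses it. -/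
theorem not_mem_of_irredundant (φ : R →ₐ[ℂ] R) (G : Finset R) {f g : R} (hf : f ∈ G) (hf0 : f ≠ 0)
    (hφf : φ f = f) (hφg : φ g = 0)
    (hirr : ∀ p ∈ G, p ≠ f → p ≠ g → 
      Ideal.span ((G : Set R) \ {p}) ≠ Ideal.span (G : Set R))
    (hdiv : ∀ p ∈ G, φ p = 0 ∨ f ∣ p) :
    Ideal.span ((G : Set R) \ {f}) ≠ Ideal.span (G : Set R) := by
  intro h
  have h1 : f ∈ Ideal.span ((G : Set R) \ {f}) := h ▸ Ideal.subset_span hf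
  have h2 : Ideal.span ((G : Set R) \ {f}) ≤ RingHom.ker φ := by
    rw [Ideal.span_le]
    rintro p ⟨hp, hpf⟩
    change φ p = 0
    by_cases hpg : p = g
    · rw [hpg, hφg]
    rcases hdiv p hp with h3 | ⟨c, hc⟩
    · exact h3
    exfalso
    apply hirr p hp hpf hpg
    apply le_antisymm (Ideal.span_mono Set.sdiff_subset)
    rw [Ideal.span_le]
    intro q hq
    by_cases hqp : q = p
    · rw [hqp]; apply Ideal.mem_of_dvd _ ⟨c, hc⟩
      exact Ideal.subset_span ⟨hf, fun h => hpf h.symm⟩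
    · exact Ideal.subset_span ⟨hq, hqp⟩
  have h3 : φ f = 0 := h2 h1
  exact hf0 (hφf ▸ h3)

theorem mem_Ipts {Y : Finset ((ℂ × ℂ) × (ℂ × ℂ))} {p : R} :
    p ∈ Ipts Y ↔ ∀ P ∈ Y, p ∈ Ipt P := by
  simp [Ipts, Submodule.mem_finsetInf]

/-- Theorem 3.3 (existence of a point splitting): for a nonempty finite set X of points
of ℙ¹×ℙ¹ (with coordinate representatives normalized so that proportional coordinate
pairs are equal), there is a minimal bihomogeneous generating set G of I_X containing
both f = H_{A₁}⋯H_{A_h} and g = V_{B₁}⋯V_{B_v}, and span {f,g} is the defining ideal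
of the grid W = {Aᵢ×Bⱼ}; in particular I_X admits a point splitting. -/
theorem statement1 (Xpts : Finset ((ℂ × ℂ) × (ℂ × ℂ))) (hne : Xpts.Nonempty)
    (hval : ∀ P ∈ Xpts, P.1 ≠ 0 ∧ P.2 ≠ 0)
    (hnorm : ∀ P ∈ Xpts, ∀ Q ∈ Xpts,
      (cross P.1 Q.1 = 0 → P.1 = Q.1) ∧ (cross P.2 Q.2 = 0 → P.2 = Q.2)) :
    ∃ G : Finset R, (∀ g' ∈ G, g' ≠ 0 ∧ Bihom g') ∧ MinGen G (Ipts Xpts) ∧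
      (∏ a ∈ Xpts.image Prod.fst, Hf a) ∈ G ∧
      (∏ b ∈ Xpts.image Prod.snd, Vf b) ∈ G ∧
      Ideal.span {∏ a ∈ Xpts.image Prod.fst, Hf a, ∏ b ∈ Xpts.image Prod.snd, Vf b} =
        Ipts ((Xpts.image Prod.fst) ×ˢ (Xpts.image Prod.snd)) := by
  have hA0 : ∀ a ∈ Xpts.image Prod.fst, a ≠ 0 := by
    intro a ha
    obtain ⟨P, hP, rfl⟩ := Finset.mem_image.1 ha
    exact (hval P hP).1
  have hB0 : ∀ a ∈ Xpts.image Prod.snd, a ≠ 0 := by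
    intro a ha
    obtain ⟨P, hP, rfl⟩ := Finset.mem_image.1 ha
    exact (hval P hP).2
  have hA : ∀ a ∈ Xpts.image Prod.fst, ∀ b ∈ Xpts.image Prod.fst, cross a b = 0 → a = b := by
    intro a ha b hb
    obtain ⟨P, hP, rfl⟩ := Finset.mem_image.1 ha
    obtain ⟨Q, hQ, rfl⟩ := Finset.mem_image.1 hb
    exact (hnorm P hP Q hQ).1
  have hB : ∀ a ∈ Xpts.image Prod.snd, ∀ b ∈ Xpts.image Prod.snd, cross a b = 0 → a = b := by
    intro a ha b hb
    obtain ⟨P, hP, rfl⟩ := Finset.mem_image.1 ha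
    obtain ⟨Q, hQ, rfl⟩ := Finset.mem_image.1 hb
    exact (hnorm P hP Q hQ).2
  have hmA : ∀ P ∈ Xpts, P.1 ∈ Xpts.image Prod.fst := fun P hP => Finset.mem_image_of_mem _ hP
  have hmB : ∀ P ∈ Xpts, P.2 ∈ Xpts.image Prod.snd := fun P hP => Finset.mem_image_of_mem _ hP
  have hsA : ∀ a ∈ Xpts.image Prod.fst, ∃ P ∈ Xpts, P.1 = a := fun a ha => Finset.mem_image.1 ha
  have hsB : ∀ a ∈ Xpts.image Prod.snd, ∃ P ∈ Xpts, P.2 = a := fun a ha => Finset.mem_image.1 ha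
  obtain ⟨P₀, hP₀⟩ := hne
  generalize Xpts.image Prod.fst = A at *
  generalize Xpts.image Prod.snd = B at *
  have hfhom : Bihom (∏ a ∈ A, Hf a) :=
    bihom_of_bw (IsWeightedHomogeneous.prod A _ _ fun a _ => hom_Hf a)
  have hghom : Bihom (∏ a ∈ B, Vf a) :=
    bihom_of_bw (IsWeightedHomogeneous.prod B _ _ fun a _ => hom_Vf a)
  have hfdef : ∏ a ∈ A, Hf a = ∏ a ∈ A, Lf 0 1 a := rfl
  have hgdef : ∏ a ∈ B, Vf a = ∏ a ∈ B, Lf 2 3 a := rfl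
  have hf0 : ∏ a ∈ A, Hf a ≠ 0 := 
    Finset.prod_ne_zero_iff.2 fun a ha => Lf_ne (i := 0) (j := 1) (by decide) (hA0 a ha)
  have hg0 : ∏ a ∈ B, Vf a ≠ 0 := 
    Finset.prod_ne_zero_iff.2 fun a ha => Lf_ne (i := 2) (j := 3) (by decide) (hB0 a ha)
  have hφf : kill 2 3 (∏ a ∈ A, Hf a) = ∏ a ∈ A, Hf a := by
    rw [map_prod]
    exact Finset.prod_congr rfl fun a _ => 
      kill_Lf_other (by decide) (by decide) (by decide) (by decide) a
  have hψg : kill 0 1 (∏ a ∈ B, Vf a) = ∏ a ∈ B, Vf a := by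
    rw [map_prod]
    exact Finset.prod_congr rfl fun a _ => 
      kill_Lf_other (by decide) (by decide) (by decide) (by decide) a
  have hφg : kill 2 3 (∏ a ∈ B, Vf a) = 0 := by
    rw [map_prod]
    exact Finset.prod_eq_zero (hmB P₀ hP₀) (kill_Lf_self 2 3 _)
  have hψf : kill 0 1 (∏ a ∈ A, Hf a) = 0 := by
    rw [map_prod]
    exact Finset.prod_eq_zero (hmA P₀ hP₀) (kill_Lf_self 0 1 _)
  have hfI : ∏ a ∈ A, Hf a ∈ Ipts Xpts := mem_Ipts.2 fun P hP =>
    Ideal.mem_of_dvd _ (Finset.dvd_prod_of_mem Hf (hmA P hP)) (Ideal.subset_span (by simp))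
  have hgI : ∏ a ∈ B, Vf a ∈ Ipts Xpts := mem_Ipts.2 fun P hP =>
    Ideal.mem_of_dvd _ (Finset.dvd_prod_of_mem Vf (hmB P hP)) (Ideal.subset_span (by simp))
  have hdivf : ∀ p ∈ Ipts Xpts, Bihom p → kill 2 3 p = 0 ∨ ∏ a ∈ A, Hf a ∣ p := by
    rintro p hp ⟨m, n, -, hn⟩
    rcases kill_of_hom (i := 2) (j := 3) (by simp) (by simp)
      (by intro k; fin_cases k <;> simp) hn with h | h
    · exact Or.inl h
    right
    refine prod_dvd (i := 0) (j := 1) (by decide) A hA0 hA ?_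
    intro a ha
    obtain ⟨P, hP, rfl⟩ := hsA a ha
    obtain ⟨u, v, huv⟩ := Ideal.mem_span_pair.1 (mem_Ipts.1 hp P hP)
    rw [← h, ← huv, map_add, map_mul, map_mul, Vf_eq, kill_Lf_self, Hf_eq,
      kill_Lf_other (by decide) (by decide) (by decide) (by decide)]
    exact ⟨kill 2 3 u, by ring⟩
  have hdivg : ∀ p ∈ Ipts Xpts, Bihom p → kill 0 1 p = 0 ∨ ∏ a ∈ B, Vf a ∣ p := by
    rintro p hp ⟨m, n, hn, -⟩
    rcases kill_of_hom (i := 0) (j := 1) (by simp) (by simp)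
      (by intro k; fin_cases k <;> simp) hn with h | h
    · exact Or.inl h
    right
    refine prod_dvd (i := 2) (j := 3) (by decide) B hB0 hB ?_
    intro a ha
    obtain ⟨P, hP, rfl⟩ := hsB a ha
    obtain ⟨u, v, huv⟩ := Ideal.mem_span_pair.1 (mem_Ipts.1 hp P hP)
    rw [← h, ← huv, map_add, map_mul, map_mul, Hf_eq, kill_Lf_self, Vf_eq,
      kill_Lf_other (by decide) (by decide) (by decide) (by decide)]
    exact ⟨kill 0 1 v, by ring⟩
  have hgrid : Ideal.span {∏ a ∈ A, Hf a, ∏ b ∈ B, Vf b} = Ipts (A ×ˢ B) := by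
    apply le_antisymm
    · rw [Ideal.span_le]
      rintro _ (rfl | rfl)
      · exact mem_Ipts.2 fun P hP => Ideal.mem_of_dvd _ 
          (Finset.dvd_prod_of_mem Hf (Finset.mem_product.1 hP).1) (Ideal.subset_span (by simp))
      · exact mem_Ipts.2 fun P hP => Ideal.mem_of_dvd _ 
          (Finset.dvd_prod_of_mem Vf (Finset.mem_product.1 hP).2) (Ideal.subset_span (by simp))
    · intro p hp
      rw [mem_Ipts] at hp
      refine inter_prod (i := 0) (j := 1) (by decide) A hA0 hA (by rw [hψg]; exact hg0) ?_
      intro a ha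
      rw [Set.pair_comm]
      refine inter_prod (i := 2) (j := 3) (by decide) B hB0 hB ?_ ?_
      · rw [kill_Lf_other (by decide) (by decide) (by decide) (by decide)]
        exact Lf_ne (by decide) (hA0 a ha)
      · intro b hb
        rw [Set.pair_comm]
        exact hp (a, b) (Finset.mk_mem_product ha hb)
  generalize ∏ a ∈ A, Hf a = f at *
  generalize ∏ b ∈ B, Vf b = g at *
  classical
  obtain ⟨S, hS, hSI⟩ := exists_hom_gens Xpts
  let Q : Finset R → Prop := fun T => f ∈ T ∧ g ∈ T ∧ (∀ p ∈ T, p ≠ 0 ∧ Bihom p) ∧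
    Ideal.span (T : Set R) = Ipts Xpts
  have hex : ∃ n, ∃ T, Q T ∧ T.card = n := by
    refine ⟨_, insert f (insert g S), ⟨by simp, by simp, ?_, ?_⟩, rfl⟩
    · intro p hp
      simp only [Finset.mem_insert] at hp
      rcases hp with rfl | rfl | hp
      · exact ⟨hf0, hfhom⟩
      · exact ⟨hg0, hghom⟩
      · exact hS p hp
    · apply le_antisymm
      · rw [Ideal.span_le]
        intro p hp
        simp only [Finset.coe_insert, Set.mem_insert_iff] at hp
        rcases hp with rfl | rfl | hp
        · exact hfI
        · exact hgI
        · rw [← hSI]; exact Ideal.subset_span hp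
      · rw [← hSI]
        apply Ideal.span_mono
        intro p hp
        simp only [Finset.coe_insert, Set.mem_insert_iff]
        exact Or.inr (Or.inr hp)
  obtain ⟨G, ⟨hGf, hGg, hGh, hGI⟩, hGc⟩ := Nat.find_spec hex
  have hirr : ∀ p ∈ G, p ≠ f → p ≠ g → 
      Ideal.span ((G : Set R) \ {p}) ≠ Ideal.span (G : Set R) := by
    intro p hp hpf hpg h
    refine Nat.find_min hex (m := (G.erase p).card) ?_ ⟨G.erase p, ⟨?_, ?_, ?_, ?_⟩, rfl⟩
    · rw [← hGc]; exact Finset.card_erase_lt_of_mem hp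
    · exact Finset.mem_erase.2 ⟨hpf.symm, hGf⟩
    · exact Finset.mem_erase.2 ⟨hpg.symm, hGg⟩
    · exact fun q hq => hGh q (Finset.mem_of_mem_erase hq)
    · rw [Finset.coe_erase, h, hGI]
  have hGmem : ∀ p ∈ G, p ∈ Ipts Xpts := fun p hp => hGI ▸ Ideal.subset_span hp
  refine ⟨G, hGh, ⟨hGI, ?_⟩, hGf, hGg, hgrid⟩
  intro p hp
  rw [← hGI]
  by_cases hpf : p = f
  · rw [hpf]
    exact not_mem_of_irredundant (kill 2 3) G hGf hf0 hφf hφg hirr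
      fun p hp => hdivf p (hGmem p hp) (hGh p hp).2
  by_cases hpg : p = g
  · rw [hpg]
    exact not_mem_of_irredundant (kill 0 1) G hGg hg0 hψg hψf
      (fun p hp h1 h2 => hirr p hp h2 h1)
      fun p hp => hdivg p (hGmem p hp) (hGh p hp).2
  exact hirr p hp hpf hpg
end
end

section
/- Given staircase data, let {f₀,…,f_r} = A ⊔ B be any partition of the staircase generators with A and B both nonempty, and set J = Ideal.span A and K = Ideal.span B. Then there exist integers a, b with 0 ≤ a ≤ t_r and 0 ≤ b ≤ s_r and a finite set Y of points of ℙ¹×ℙ¹ which is a Ferrers configuration built on the points {Aᵢ : a < i ≤ t_r} and {Bⱼ : b < j ≤ s_r} — so that no point of Y lies on any of the lines H₁,…,H_a, V₁,…,V_b — such that J ⊓ K = ⟨H₁⋯H_a · V₁⋯V_b⟩ * I_Y. In other words, J ⊓ K is the defining ideal of a union of lines and ACM points. -/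
/- Common setup: R = ℂ[x₀,x₁,y₀,y₁] as MvPolynomial (Fin 4) ℂ with
   x₀ = X 0, x₁ = X 1, y₀ = X 2, y₁ = X 3.
   `Hf a` is the horizontal form a₁x₀ - a₀x₁ of the point a = [a₀:a₁] ∈ ℙ¹;
   `Vf b` is the vertical form b₁y₀ - b₀y₁;
   `cross a b ≠ 0` says the (nonzero) pairs a, b are non-proportional,
   i.e. define distinct points of ℙ¹. -/

open MvPolynomial

noncomputable section

/-- Staircase data: r ≥ 1, 0 = t₀ < t₁ < ⋯ < t_r, 0 = s₀ < s₁ < ⋯ < s_r,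
    pairwise distinct points A₁,…,A_{t_r} of ℙ¹ and pairwise distinct points
    B₁,…,B_{s_r} of ℙ¹ (all indexed starting at 1). -/
structure Staircase where
  r : ℕ
  t : ℕ → ℕ
  s : ℕ → ℕ
  A : ℕ → ℂ × ℂ
  B : ℕ → ℂ × ℂ
  hr : 1 ≤ r
  ht0 : t 0 = 0
  hs0 : s 0 = 0
  ht : ∀ k, k < r → t k < t (k + 1)
  hs : ∀ k, k < r → s k < s (k + 1)
  hA0 : ∀ i ∈ Finset.Icc 1 (t r), A i ≠ 0
  hB0 : ∀ j ∈ Finset.Icc 1 (s r), B j ≠ 0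
  hAd : ∀ i ∈ Finset.Icc 1 (t r), ∀ i' ∈ Finset.Icc 1 (t r), i ≠ i' → cross (A i) (A i') ≠ 0
  hBd : ∀ j ∈ Finset.Icc 1 (s r), ∀ j' ∈ Finset.Icc 1 (s r), j ≠ j' → cross (B j) (B j') ≠ 0

/-- The staircase generator f_k = H₁⋯H_{t_k} · V₁⋯V_{s_{r-k}}. -/
def stairGen (S : Staircase) (k : ℕ) : R :=
  (∏ i ∈ Finset.Icc 1 (S.t k), Hf (S.A i)) * ∏ j ∈ Finset.Icc 1 (S.s (S.r - k)), Vf (S.B j)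

/-- A Ferrers configuration {Aᵢ×Bⱼ : 1 ≤ i ≤ h, 1 ≤ j ≤ αᵢ} for pairwise distinct
    points A₁,…,A_h of ℙ¹, pairwise distinct B₁,…,B_{α₁} of ℙ¹ and
    α₁ ≥ ⋯ ≥ α_h ≥ 1.  These are exactly the ACM finite sets of points of ℙ¹×ℙ¹. -/
def IsFerrers (W : Set ((ℂ × ℂ) × (ℂ × ℂ))) : Prop :=
  ∃ (h : ℕ) (α : ℕ → ℕ) (A B : ℕ → ℂ × ℂ),
    1 ≤ h ∧
    (∀ i, 1 ≤ i → i ≤ h → 1 ≤ α i) ∧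
    (∀ i, 1 ≤ i → i + 1 ≤ h → α (i + 1) ≤ α i) ∧
    (∀ i, 1 ≤ i → i ≤ h → A i ≠ 0) ∧
    (∀ j, 1 ≤ j → j ≤ α 1 → B j ≠ 0) ∧
    (∀ i i', 1 ≤ i → i ≤ h → 1 ≤ i' → i' ≤ h → i ≠ i' → cross (A i) (A i') ≠ 0) ∧
    (∀ j j', 1 ≤ j → j ≤ α 1 → 1 ≤ j' → j' ≤ α 1 → j ≠ j' → cross (B j) (B j') ≠ 0) ∧
    W = {P | ∃ i j, 1 ≤ i ∧ i ≤ h ∧ 1 ≤ j ∧ j ≤ α i ∧ P = (A i, B j)}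


theorem stair_inf {T : Type*} [CommRing T] [IsDomain T] (p q : ℕ → T) (N : ℕ) (b : ℕ → ℕ)
    (p0 : p 0 = 1) (hpd : ∀ i j, i ≤ j → p i ∣ p j) (hpN : p (N + 1) = 0)
    (hqd : ∀ i j, i ≤ j → q i ∣ q j) (hb : Antitone b)
    (cop : ∀ i j d, p i ∣ q j * d → q j = 0 ∨ p i ∣ d) :
    Ideal.span (Set.range fun i => p i * q (b i)) =
      ⨅ i, Ideal.span {p (i + 1), q (b i)} := by
  apply le_antisymm
  · rw [Ideal.span_le]
    rintro _ ⟨i, rfl⟩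
    simp only [SetLike.mem_coe, Ideal.mem_iInf]
    intro k
    rcases le_or_gt (k + 1) i with h | h
    · exact Ideal.mul_mem_right _ _ (Ideal.mem_of_dvd _ (hpd _ _ h) (Ideal.subset_span (by simp)))
    · exact Ideal.mul_mem_left _ _ (Ideal.mem_of_dvd _ (hqd (b k) _ (hb (by omega)))
        (Ideal.subset_span (by simp)))
  · intro f hf
    rw [Ideal.mem_iInf] at hf
    have key : ∀ n, ∃ u g, u ∈ Ideal.span (Set.range fun i => p i * q (b i)) ∧
        q (b n) ∣ u ∧ f = u + p n * g := by
      intro n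
      induction n with
      | zero => exact ⟨0, f, by simp, by simp, by simp [p0]⟩
      | succ n ih =>
        obtain ⟨u, g, hu, ⟨w, hw⟩, hfu⟩ := ih
        obtain ⟨c, d, hcd⟩ := Ideal.mem_span_pair.1 (hf n)
        obtain ⟨h, hh⟩ := hpd n (n + 1) (by omega)
        have h1 : p n * (g - h * c) = q (b n) * (d - w) := by
          rw [hfu, hh, hw] at hcd
          linear_combination -hcd
        have h2 : ∃ e, p n * (g - h * c) = p n * q (b n) * e := by
          rcases cop n (b n) (d - w) ⟨_, h1.symm⟩ with h3 | ⟨e, he⟩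
          · exact ⟨0, by rw [h1, h3]; simp⟩
          · exact ⟨e, by rw [h1, he]; ring⟩
        obtain ⟨e, he⟩ := h2
        refine ⟨u + p n * q (b n) * e, c, ?_, ?_, ?_⟩
        · exact Ideal.add_mem _ hu (Ideal.mul_mem_right _ _ (Ideal.subset_span ⟨n, rfl⟩))
        · refine (hqd _ _ (hb (Nat.le_succ n))).trans ⟨w + p n * e, ?_⟩
          rw [hw]; ring
        · rw [hfu, hh]; linear_combination he
    obtain ⟨u, g, hu, -, h⟩ := key (N + 1)
    rw [h, hpN]; simpa using hu

theorem pts_inf {T : Type*} [CommRing T] (h v : ℕ → T) (N : ℕ) (c : ℕ → ℕ)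
    (hc : Antitone c) (hcN : c N = 0)
    (hprime : ∀ i j, i < N → j < c i → (Ideal.span {h i, v j}).IsPrime)
    (hh : ∀ i j k, i < N → j < c i → k < i → h k ∉ Ideal.span {h i, v j})
    (hv : ∀ i j k, i < N → j < c i → k < j → v k ∉ Ideal.span {h i, v j}) (f : T) :
    f ∈ Ideal.span ((fun i => (∏ k ∈ Finset.range i, h k) * ∏ k ∈ Finset.range (c i), v k) ''
        Set.Iic N) ↔ ∀ i j, i < N → j < c i → f ∈ Ideal.span {h i, v j} := by
  constructor
  · intro hf i j hi hj
    revert f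
    change Ideal.span _ ≤ _
    rw [Ideal.span_le]
    rintro _ ⟨k, -, rfl⟩
    rcases lt_or_ge i k with hk | hk
    · exact Ideal.mul_mem_right _ _ (Ideal.mem_of_dvd _
        (Finset.dvd_prod_of_mem h (Finset.mem_range.2 hk)) (Ideal.subset_span (by simp)))
    · exact Ideal.mul_mem_left _ _ (Ideal.mem_of_dvd _
        (Finset.dvd_prod_of_mem v (Finset.mem_range.2 (hj.trans_le (hc hk))))
        (Ideal.subset_span (by simp)))
  · intro hf
    have key : ∀ n, n ≤ N → ∃ u g, u ∈ Ideal.span ((fun i => (∏ k ∈ Finset.range i, h k) *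
        ∏ k ∈ Finset.range (c i), v k) '' Set.Iic N) ∧
        (∏ k ∈ Finset.range (c n), v k) ∣ u ∧ f = u + (∏ k ∈ Finset.range n, h k) * g := by
      intro n
      induction n with
      | zero => intro _; exact ⟨0, f, by simp, by simp, by simp⟩
      | succ n ih =>
        intro hn
        obtain ⟨u, g, hu, hw, hfu⟩ := ih (by omega)
        have hg : ∀ j, j < c n → g ∈ Ideal.span {h n, v j} := by
          intro j hj
          have hpr := hprime n j (by omega) hj
          have h1 : (∏ k ∈ Finset.range n, h k) * g ∈ Ideal.span {h n, v j} := by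
            have h2 : u ∈ Ideal.span {h n, v j} := Ideal.mem_of_dvd _
              ((Finset.dvd_prod_of_mem v (Finset.mem_range.2 hj)).trans hw)
              (Ideal.subset_span (by simp))
            have h3 := hf n j (by omega) hj
            rw [hfu] at h3
            exact (Ideal.add_mem_iff_right _ h2).1 h3
          refine (hpr.mem_or_mem h1).resolve_left ?_
          intro h4
          obtain ⟨k, hk, hk'⟩ := (hpr.prod_mem_iff).1 h4
          exact hh n j k (by omega) hj (Finset.mem_range.1 hk) hk'
        have hm : ∀ m, m ≤ c n → ∃ x e, g = h n * x + (∏ k ∈ Finset.range m, v k) * e := by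
          intro m
          induction m with
          | zero => intro _; exact ⟨0, g, by simp⟩
          | succ m ihm =>
            intro hm
            obtain ⟨x, e, hxe⟩ := ihm (by omega)
            have hpr := hprime n m (by omega) hm
            have h1 : (∏ k ∈ Finset.range m, v k) * e ∈ Ideal.span {h n, v m} := by
              have h3 := hg m hm
              rw [hxe] at h3
              exact (Ideal.add_mem_iff_right _
                (Ideal.mul_mem_right _ _ (Ideal.subset_span (by simp)))).1 h3
            have h5 : e ∈ Ideal.span {h n, v m} := by
              refine (hpr.mem_or_mem h1).resolve_left ?_
              intro h4
              obtain ⟨k, hk, hk'⟩ := (hpr.prod_mem_iff).1 h4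
              exact hv n m k (by omega) hm (Finset.mem_range.1 hk) hk'
            obtain ⟨y, z, hyz⟩ := Ideal.mem_span_pair.1 h5
            refine ⟨x + (∏ k ∈ Finset.range m, v k) * y, z, ?_⟩
            rw [hxe, ← hyz, Finset.prod_range_succ]; ring
        obtain ⟨x, e, hxe⟩ := hm _ le_rfl
        refine ⟨u + (∏ k ∈ Finset.range n, h k) * (∏ k ∈ Finset.range (c n), v k) * e, x,
          ?_, ?_, ?_⟩
        · exact Ideal.add_mem _ hu (Ideal.mul_mem_right _ _
            (Ideal.subset_span ⟨n, by simp; omega, rfl⟩))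
        · refine (Finset.prod_dvd_prod_of_subset _ _ _
            (Finset.range_mono (hc (Nat.le_succ n)))).trans (dvd_add hw ?_)
          exact Dvd.intro_left (∏ k ∈ Finset.range n, h k) rfl |>.mul_right e
        · rw [hfu, hxe, Finset.prod_range_succ]; ring
    obtain ⟨u, g, hu, -, h⟩ := key N le_rfl
    rw [h]
    refine Ideal.add_mem _ hu (Ideal.mul_mem_right _ _ (Ideal.subset_span ⟨N, by simp, ?_⟩))
    simp [hcN]

/-- retraction sending both coordinates into a line -/
def tauMap (a b l m : ℂ × ℂ) : R →ₐ[ℂ] R :=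
  aeval ![C a.1 * (C l.1 * X 0 + C l.2 * X 1), C a.2 * (C l.1 * X 0 + C l.2 * X 1),
    C b.1 * (C m.1 * X 2 + C m.2 * X 3), C b.2 * (C m.1 * X 2 + C m.2 * X 3)]

theorem exists_dual (a : ℂ × ℂ) (ha : a ≠ 0) : ∃ l : ℂ × ℂ, l.1 * a.1 + l.2 * a.2 = 1 := by
  by_cases h : a.1 = 0
  · have h2 : a.2 ≠ 0 := fun h2 => ha (Prod.ext h h2)
    exact ⟨(0, a.2⁻¹), by simp [h2]⟩
  · exact ⟨(a.1⁻¹, 0), by simp [h]⟩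

theorem Ipt_prime (a b : ℂ × ℂ) (ha : a ≠ 0) (hb : b ≠ 0) :
    (Ideal.span {Hf a, Vf b}).IsPrime := by
  obtain ⟨l, hl⟩ := exists_dual a ha
  obtain ⟨m, hm⟩ := exists_dual b hb
  have hl' : (C l.1 * C a.1 + C l.2 * C a.2 : R) = 1 := by
    rw [← C_mul, ← C_mul, ← C_add, hl, C_1]
  have hm' : (C m.1 * C b.1 + C m.2 * C b.2 : R) = 1 := by
    rw [← C_mul, ← C_mul, ← C_add, hm, C_1]
  have hker : Ideal.span {Hf a, Vf b} = RingHom.ker (tauMap a b l m) := by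
    apply le_antisymm
    · rw [Ideal.span_le]
      intro x hx
      simp only [SetLike.mem_coe, RingHom.mem_ker]
      rcases hx with rfl | rfl
      · simp [tauMap, Hf, algHom_C, algebraMap_eq]; ring
      · simp [tauMap, Vf, algHom_C, algebraMap_eq]; ring
    · intro f hf
      have hmod : ∀ f : R, Ideal.Quotient.mk (Ideal.span {Hf a, Vf b}) (tauMap a b l m f) =
          Ideal.Quotient.mk (Ideal.span {Hf a, Vf b}) f := by
        have : ((Ideal.Quotient.mkₐ ℂ (Ideal.span {Hf a, Vf b})).comp (tauMap a b l m)) =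
            Ideal.Quotient.mkₐ ℂ (Ideal.span {Hf a, Vf b}) := by
          apply MvPolynomial.algHom_ext
          intro i
          simp only [AlgHom.comp_apply, Ideal.Quotient.mkₐ_eq_mk]
          rw [Ideal.Quotient.eq]
          rw [Ideal.mem_span_pair]
          fin_cases i
          · refine ⟨-C l.2, 0, ?_⟩
            simp [tauMap, Hf]; linear_combination -(X 0) * hl'
          · refine ⟨C l.1, 0, ?_⟩
            simp [tauMap, Hf]; linear_combination -(X 1) * hl'
          · refine ⟨0, -C m.2, ?_⟩
            simp [tauMap, Vf]; linear_combination -(X 2) * hm'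
          · refine ⟨0, C m.1, ?_⟩
            simp [tauMap, Vf]; linear_combination -(X 3) * hm'
        intro f
        exact DFunLike.congr_fun this f
      rw [RingHom.mem_ker] at hf
      have := hmod f
      rw [hf, map_zero] at this
      exact Ideal.Quotient.eq_zero_iff_mem.1 this.symm
  rw [hker]
  exact RingHom.ker_isPrime _

theorem eval_Ipt (a b : ℂ × ℂ) (f : R) (hf : f ∈ Ideal.span {Hf a, Vf b}) :
    eval ![a.1, a.2, b.1, b.2] f = 0 := by
  obtain ⟨c, d, rfl⟩ := Ideal.mem_span_pair.1 hf
  simp [Hf, Vf]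
  rw [mul_comm a.2, sub_self, mul_comm b.2, sub_self]; simp

theorem Hf_notMem (a b a' : ℂ × ℂ) (h : cross a' a ≠ 0) : Hf a' ∉ Ideal.span {Hf a, Vf b} := by
  intro hf
  apply h
  have := eval_Ipt a b _ hf
  simp [Hf] at this
  rw [cross]; linear_combination -this

theorem Vf_notMem (a b b' : ℂ × ℂ) (h : cross b' b ≠ 0) : Vf b' ∉ Ideal.span {Hf a, Vf b} := by
  intro hf
  apply h
  have := eval_Ipt a b _ hf
  simp [Vf] at this
  rw [cross]; linear_combination -this

/-- retraction onto the hypersurface Hf a = 0 -/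
def tauH (a l : ℂ × ℂ) : R →ₐ[ℂ] R :=
  aeval ![C a.1 * (C l.1 * X 0 + C l.2 * X 1), C a.2 * (C l.1 * X 0 + C l.2 * X 1), X 2, X 3]

theorem Hf_ne (a : ℂ × ℂ) (ha : a ≠ 0) : Hf a ≠ 0 := by
  obtain ⟨l, hl⟩ := exists_dual a ha
  intro h
  have := congrArg (eval ![l.2, -l.1, 0, 0]) h
  simp [Hf] at this
  have : (1 : ℂ) = 0 := by rw [← hl]; linear_combination this
  exact one_ne_zero this

theorem Vf_ne (a : ℂ × ℂ) (ha : a ≠ 0) : Vf a ≠ 0 := by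
  obtain ⟨l, hl⟩ := exists_dual a ha
  intro h
  have := congrArg (eval ![0, 0, l.2, -l.1]) h
  simp [Vf] at this
  have : (1 : ℂ) = 0 := by rw [← hl]; linear_combination this
  exact one_ne_zero this

theorem Hf_prime (a : ℂ × ℂ) (ha : a ≠ 0) : Prime (Hf a) := by
  rw [← Ideal.span_singleton_prime (Hf_ne a ha)]
  obtain ⟨l, hl⟩ := exists_dual a ha
  have hl' : (C l.1 * C a.1 + C l.2 * C a.2 : R) = 1 := by
    rw [← C_mul, ← C_mul, ← C_add, hl, C_1]
  have hker : Ideal.span {Hf a} = RingHom.ker (tauH a l) := by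
    apply le_antisymm
    · rw [Ideal.span_le]
      intro x hx
      simp only [SetLike.mem_coe, RingHom.mem_ker]
      rcases hx with rfl
      simp [tauH, Hf, algHom_C, algebraMap_eq]; ring
    · intro f hf
      have hmod : ∀ f : R, Ideal.Quotient.mk (Ideal.span {Hf a}) (tauH a l f) =
          Ideal.Quotient.mk (Ideal.span {Hf a}) f := by
        have : ((Ideal.Quotient.mkₐ ℂ (Ideal.span {Hf a})).comp (tauH a l)) =
            Ideal.Quotient.mkₐ ℂ (Ideal.span {Hf a}) := by
          apply MvPolynomial.algHom_ext
          intro i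
          simp only [AlgHom.comp_apply, Ideal.Quotient.mkₐ_eq_mk]
          rw [Ideal.Quotient.eq]
          rw [Ideal.mem_span_singleton']
          fin_cases i
          · refine ⟨-C l.2, ?_⟩
            simp [tauH, Hf]; linear_combination -(X 0) * hl'
          · refine ⟨C l.1, ?_⟩
            simp [tauH, Hf]; linear_combination -(X 1) * hl'
          · exact ⟨0, by simp [tauH]⟩
          · exact ⟨0, by simp [tauH]⟩
        intro f
        exact DFunLike.congr_fun this f
      rw [RingHom.mem_ker] at hf
      have := hmod f
      rw [hf, map_zero] at this
      exact Ideal.Quotient.eq_zero_iff_mem.1 this.symm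
  rw [hker]
  exact RingHom.ker_isPrime _

theorem Hf_not_dvd_Vf (a b : ℂ × ℂ) (hb : b ≠ 0) : ¬ Hf a ∣ Vf b := by
  rintro ⟨c, hc⟩
  obtain ⟨l, hl⟩ := exists_dual b hb
  have := congrArg (eval ![a.1, a.2, l.2, -l.1]) hc
  simp [Hf, Vf] at this
  have : (1 : ℂ) = 0 := by rw [← hl]; linear_combination this
  exact one_ne_zero this

theorem cop_prod (s : Finset ℕ) (A : ℕ → ℂ × ℂ) (hA : ∀ i ∈ s, A i ≠ 0) (u : Finset ℕ)
    (B : ℕ → ℂ × ℂ) (hB : ∀ i ∈ u, B i ≠ 0) (d : R)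
    (h : (∏ i ∈ s, Hf (A i)) ∣ (∏ i ∈ u, Vf (B i)) * d) : (∏ i ∈ s, Hf (A i)) ∣ d := by
  refine IsRelPrime.dvd_of_dvd_mul_left ?_ h
  refine IsRelPrime.prod_left fun i hi => IsRelPrime.prod_right fun j hj => ?_
  exact (Hf_prime _ (hA i hi)).irreducible.isRelPrime_iff_not_dvd.2 (Hf_not_dvd_Vf _ _ (hB j hj))

/-- `P n = H₁⋯H_n` for `n ≤ t_r`, and `0` afterwards. -/
def pS (S : Staircase) (n : ℕ) : R :=
  if n ≤ S.t S.r then ∏ i ∈ Finset.Icc 1 n, Hf (S.A i) else 0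

/-- `Q n = V₁⋯V_n` for `n ≤ s_r`, and `0` afterwards. -/
def qS (S : Staircase) (n : ℕ) : R :=
  if n ≤ S.s S.r then ∏ i ∈ Finset.Icc 1 n, Vf (S.B i) else 0

theorem prod_Icc_dvd (f : ℕ → R) {i j : ℕ} (h : i ≤ j) :
    (∏ k ∈ Finset.Icc 1 i, f k) ∣ ∏ k ∈ Finset.Icc 1 j, f k :=
  Finset.prod_dvd_prod_of_subset _ _ _ (Finset.Icc_subset_Icc_right h)

theorem pS_dvd (S : Staircase) (i j : ℕ) (h : i ≤ j) : pS S i ∣ pS S j := by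
  unfold pS
  split_ifs with h1 h2 h2
  · exact prod_Icc_dvd _ h
  · exact dvd_zero _
  · omega
  · exact dvd_zero _

theorem qS_dvd (S : Staircase) (i j : ℕ) (h : i ≤ j) : qS S i ∣ qS S j := by
  unfold qS
  split_ifs with h1 h2 h2
  · exact prod_Icc_dvd _ h
  · exact dvd_zero _
  · omega
  · exact dvd_zero _

theorem pq_cop (S : Staircase) (i j : ℕ) (d : R) (h : pS S i ∣ qS S j * d) :
    qS S j = 0 ∨ pS S i ∣ d := by
  by_cases h2 : j ≤ S.s S.r
  · right
    by_cases h1 : i ≤ S.t S.r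
    · rw [pS, if_pos h1] at *
      rw [qS, if_pos h2] at h
      refine cop_prod _ _ (fun k hk => S.hA0 k ?_) _ _ (fun k hk => S.hB0 k ?_) _ h
      · simp only [Finset.mem_Icc] at *; omega
      · simp only [Finset.mem_Icc] at *; omega
    · rw [pS, if_neg h1] at *
      rw [qS, if_pos h2] at h
      rw [zero_dvd_iff] at h ⊢
      refine (mul_eq_zero.1 h).resolve_left ?_
      refine Finset.prod_ne_zero_iff.2 ?_
      intro k hk
      refine Vf_ne _ (S.hB0 k ?_)
      simp only [Finset.mem_Icc] at *; omega
  · left; rw [qS, if_neg h2]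

theorem stairS (S : Staircase) (b : ℕ → ℕ) (hb : Antitone b) :
    Ideal.span (Set.range fun i => pS S i * qS S (b i)) =
      ⨅ i, Ideal.span {pS S (i + 1), qS S (b i)} :=
  stair_inf (pS S) (qS S) (S.t S.r) b (by simp [pS]) (pS_dvd S) (by simp [pS]) (qS_dvd S) hb
    (pq_cop S)

theorem span_pair_le (S : Staircase) (i m n : ℕ) (h : m ≤ n) :
    Ideal.span {pS S i, qS S n} ≤ Ideal.span {pS S i, qS S m} := by
  rw [Ideal.span_le]
  rintro x (rfl | rfl)
  · exact Ideal.subset_span (by simp)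
  · exact Ideal.mem_of_dvd _ (qS_dvd S m n h) (Ideal.subset_span (by simp))

theorem stairS_inf (S : Staircase) (b c : ℕ → ℕ) (hb : Antitone b) (hc : Antitone c) :
    Ideal.span (Set.range fun i => pS S i * qS S (b i)) ⊓
      Ideal.span (Set.range fun i => pS S i * qS S (c i)) =
    Ideal.span (Set.range fun i => pS S i * qS S (max (b i) (c i))) := by
  rw [stairS S b hb, stairS S c hc,
    stairS S (fun i => max (b i) (c i)) (fun i j h => max_le_max (hb h) (hc h)), ← iInf_inf_eq]
  refine iInf_congr fun i => ?_
  rcases le_total (b i) (c i) with h | h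
  · rw [max_eq_right h]; exact inf_eq_right.2 (span_pair_le S _ _ _ h)
  · rw [max_eq_left h]; exact inf_eq_left.2 (span_pair_le S _ _ _ h)

theorem mono_upto (t : ℕ → ℕ) (r : ℕ) (ht : ∀ k, k < r → t k < t (k + 1)) (k : ℕ) (hk : k ≤ r) :
    t k ≤ t r := by
  induction r, hk using Nat.le_induction with
  | base => exact le_rfl
  | succ n hn ih => exact (ih fun k hk => ht k (by omega)).trans (ht n (by omega)).le

/-- The set of heights available over column `i` for the generators in `K`. -/
def hset (S : Staircase) (K : Set ℕ) (i : ℕ) : Set ℕ :=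
  {n | n = S.s S.r + 1 ∨ ∃ k ∈ K, S.t k ≤ i ∧ n = S.s (S.r - k)}

theorem hset_anti (S : Staircase) (K : Set ℕ) : Antitone fun i => sInf (hset S K i) := by
  intro i j h
  apply Nat.sInf_le
  rcases Nat.sInf_mem (⟨_, Or.inl rfl⟩ : (hset S K i).Nonempty) with h1 | ⟨k, hk, h1, h2⟩
  · exact Or.inl h1
  · exact Or.inr ⟨k, hk, h1.trans h, h2⟩

theorem span_eq_stair (S : Staircase) (K : Set ℕ) (hK : K ⊆ Set.Iic S.r) :
    Ideal.span (stairGen S '' K) =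
      Ideal.span (Set.range fun i => pS S i * qS S (sInf (hset S K i))) := by
  have hgen : ∀ k ∈ K, stairGen S k = pS S (S.t k) * qS S (S.s (S.r - k)) := by
    intro k hk
    have h1 := mono_upto S.t S.r S.ht k (hK hk)
    have h2 := mono_upto S.s S.r S.hs (S.r - k) (by omega)
    simp [stairGen, pS, qS, h1, h2]
  apply le_antisymm
  · rw [Ideal.span_le]
    rintro _ ⟨k, hk, rfl⟩
    rw [hgen k hk]
    have h1 : sInf (hset S K (S.t k)) ≤ S.s (S.r - k) :=
      Nat.sInf_le (Or.inr ⟨k, hk, le_rfl, rfl⟩)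
    exact Ideal.mem_of_dvd _ (mul_dvd_mul_left _ (qS_dvd S _ _ h1))
      (Ideal.subset_span ⟨S.t k, rfl⟩)
  · rw [Ideal.span_le]
    rintro _ ⟨i, rfl⟩
    simp only
    rcases Nat.sInf_mem (⟨_, Or.inl rfl⟩ : (hset S K i).Nonempty) with h1 | ⟨k, hk, h1, h2⟩
    · rw [h1]; simp [qS]
    · rw [h2]
      exact Ideal.mem_of_dvd _ (mul_dvd_mul_right (pS_dvd S _ _ h1) _)
        (Ideal.subset_span ⟨k, hk, hgen k hk⟩)

theorem prod_shift (f : ℕ → R) (a n : ℕ) : (∏ i ∈ Finset.Icc 1 (a + n), f i) =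
    (∏ i ∈ Finset.Icc 1 a, f i) * ∏ i ∈ Finset.range n, f (a + 1 + i) := by
  induction n with
  | zero => simp
  | succ n ih =>
    rw [← add_assoc, Finset.prod_Icc_succ_top (by omega), ih, Finset.prod_range_succ, mul_assoc]
    congr 3; omega

open scoped Pointwise in
theorem stair_final (S : Staircase) (c : ℕ → ℕ) (hc : Antitone c) (hct : c (S.t S.r) ≤ S.s S.r) :
    ∃ a b : ℕ, a ≤ S.t S.r ∧ b ≤ S.s S.r ∧
      ∃ Y : Set ((ℂ × ℂ) × (ℂ × ℂ)),
        (Y = ∅ ∨ IsFerrers Y) ∧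
        Y ⊆ {P | ∃ i j, a < i ∧ i ≤ S.t S.r ∧ b < j ∧ j ≤ S.s S.r ∧
          P = (S.A i, S.B j)} ∧
        Ideal.span (Set.range fun i => pS S i * qS S (c i)) =
          Ideal.span {(∏ i ∈ Finset.Icc 1 a, Hf (S.A i)) *
              ∏ j ∈ Finset.Icc 1 b, Vf (S.B j)} * IptsSet Y := by
  classical
  have hex : ∃ a, c a ≤ S.s S.r := ⟨_, hct⟩
  obtain ⟨a, haS, hat, hamin⟩ : ∃ a, c a ≤ S.s S.r ∧ a ≤ S.t S.r ∧ ∀ i < a, S.s S.r < c i :=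
    ⟨Nat.find hex, Nat.find_spec hex, Nat.find_min' hex hct,
      fun i hi => not_le.1 (Nat.find_min hex hi)⟩
  set b := c (S.t S.r) with hbdef
  have hex2 : ∃ n, c (a + n) ≤ b := ⟨S.t S.r - a, by rw [Nat.add_sub_cancel' hat]⟩
  obtain ⟨N, hN, hNt, hNmin⟩ : ∃ n, c (a + n) ≤ b ∧ a + n ≤ S.t S.r ∧ ∀ i < n, b < c (a + i) := by
    refine ⟨Nat.find hex2, Nat.find_spec hex2, ?_, fun i hi => not_le.1 (Nat.find_min hex2 hi)⟩
    have : Nat.find hex2 ≤ S.t S.r - a := Nat.find_min' hex2 (by rw [Nat.add_sub_cancel' hat])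
    omega
  have hNb : c (a + N) = b := le_antisymm hN (hc hNt)
  have hca : ∀ i, c (a + i) ≤ S.s S.r := fun i => (hc (by omega)).trans haS
  have hmemA : ∀ i, i < N → a + 1 + i ∈ Finset.Icc 1 (S.t S.r) := by
    intro i hi; rw [Finset.mem_Icc]; omega
  have hmemB : ∀ i j, j < c (a + i) - b → b + 1 + j ∈ Finset.Icc 1 (S.s S.r) := by
    intro i j hi; rw [Finset.mem_Icc]; have := hca i; omega
  refine ⟨a, b, hat, hct, {P | ∃ i j, i < N ∧ j < c (a + i) - b ∧
    P = (S.A (a + 1 + i), S.B (b + 1 + j))}, ?_, ?_, ?_⟩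
  · rcases Nat.eq_zero_or_pos N with h0 | h0
    · left
      ext P
      simp [h0]
    · right
      refine ⟨N, fun i => c (a + (i - 1)) - b, fun i => S.A (a + i), fun j => S.B (b + j), h0,
        ?_, ?_, ?_, ?_, ?_, ?_, ?_⟩
      · intro i hi hiN
        have := hNmin (i - 1) (by omega)
        simp only; omega
      · intro i hi hiN
        exact Nat.sub_le_sub_right (hc (by omega)) _
      · intro i hi hiN
        exact S.hA0 _ (by rw [Finset.mem_Icc]; omega)
      · intro j hj hj'
        have := hca 0
        simp only [Nat.sub_self] at hj'
        exact S.hB0 _ (by rw [Finset.mem_Icc]; omega)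
      · intro i i' h1 h2 h3 h4 h5
        exact S.hAd _ (by rw [Finset.mem_Icc]; omega) _ (by rw [Finset.mem_Icc]; omega) (by omega)
      · intro i i' h1 h2 h3 h4 h5
        have := hca 0
        simp only [Nat.sub_self] at h2 h4
        exact S.hBd _ (by rw [Finset.mem_Icc]; omega) _ (by rw [Finset.mem_Icc]; omega) (by omega)
      · ext P
        constructor
        · rintro ⟨i, j, hi, hj, rfl⟩
          refine ⟨i + 1, j + 1, by omega, by omega, by omega, ?_, ?_⟩
          · simp only [Nat.add_sub_cancel]; omega
          · simp only [Prod.mk.injEq]; constructor <;> congr 1 <;> omega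
        · rintro ⟨i, j, h1, h2, h3, h4, rfl⟩
          simp only at h4
          refine ⟨i - 1, j - 1, by omega, by omega, ?_⟩
          simp only [Prod.mk.injEq]; constructor <;> congr 1 <;> omega
  · rintro P ⟨i, j, hi, hj, rfl⟩
    have h1 := hmemA i hi
    have h2 := hmemB i j hj
    rw [Finset.mem_Icc] at h1 h2
    exact ⟨a + 1 + i, b + 1 + j, by omega, h1.2, by omega, h2.2, rfl⟩
  · have hY : IptsSet {P | ∃ i j, i < N ∧ j < c (a + i) - b ∧
        P = (S.A (a + 1 + i), S.B (b + 1 + j))} =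
        Ideal.span ((fun i => (∏ k ∈ Finset.range i, Hf (S.A (a + 1 + k))) *
          ∏ k ∈ Finset.range (c (a + i) - b), Vf (S.B (b + 1 + k))) '' Set.Iic N) := by
      ext f
      refine Iff.trans ?_ (pts_inf (fun k => Hf (S.A (a + 1 + k))) (fun k => Vf (S.B (b + 1 + k))) N
        (fun i => c (a + i) - b)
        (fun i j h => Nat.sub_le_sub_right (hc (by omega)) _) (by simp only [hNb, Nat.sub_self])
        ?_ ?_ ?_ f).symm
      · simp only [IptsSet, Ideal.mem_iInf]
        constructor
        · intro h i j hi hj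
          have := h (S.A (a + 1 + i), S.B (b + 1 + j)) ⟨i, j, hi, hj, rfl⟩
          rwa [Ipt] at this
        · rintro h _ ⟨i, j, hi, hj, rfl⟩
          rw [Ipt]
          exact h i j hi hj
      · intro i j hi hj
        exact Ipt_prime _ _ (S.hA0 _ (hmemA i hi)) (S.hB0 _ (hmemB i j hj))
      · intro i j k hi hj hk
        exact Hf_notMem _ _ _ (S.hAd _ (hmemA k (by omega)) _ (hmemA i hi) (by omega))
      · intro i j k hi hj hk
        exact Vf_notMem _ _ _ (S.hBd _ (hmemB i k (by omega)) _ (hmemB i j hj) (by omega))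
    have hfac : ∀ i ≤ N, pS S (a + i) * qS S (c (a + i)) =
        ((∏ i ∈ Finset.Icc 1 a, Hf (S.A i)) * ∏ j ∈ Finset.Icc 1 b, Vf (S.B j)) *
        ((∏ k ∈ Finset.range i, Hf (S.A (a + 1 + k))) *
          ∏ k ∈ Finset.range (c (a + i) - b), Vf (S.B (b + 1 + k))) := by
      intro i hi
      have hbc : b ≤ c (a + i) := hc (by omega)
      have h2 : (∏ j ∈ Finset.Icc 1 (c (a + i)), Vf (S.B j)) =
          (∏ j ∈ Finset.Icc 1 b, Vf (S.B j)) *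
          ∏ k ∈ Finset.range (c (a + i) - b), Vf (S.B (b + 1 + k)) := by
        rw [← prod_shift (fun j => Vf (S.B j)), Nat.add_sub_cancel' hbc]
      rw [pS, qS, if_pos (by omega), if_pos (hca i), prod_shift (fun j => Hf (S.A j)), h2]
      ring
    rw [hY, Ideal.span_mul_span']
    apply le_antisymm
    · rw [Ideal.span_le]
      have hin : ∀ i ≤ N, pS S (a + i) * qS S (c (a + i)) ∈ Ideal.span
          ((({(∏ i ∈ Finset.Icc 1 a, Hf (S.A i)) * ∏ j ∈ Finset.Icc 1 b, Vf (S.B j)} : Set R) *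
          ((fun i => (∏ k ∈ Finset.range i, Hf (S.A (a + 1 + k))) *
          ∏ k ∈ Finset.range (c (a + i) - b), Vf (S.B (b + 1 + k))) '' Set.Iic N)) : Set R) := by
        intro i hi
        rw [hfac i hi]
        exact Ideal.subset_span (Set.mul_mem_mul rfl ⟨i, hi, rfl⟩)
      rintro _ ⟨i, rfl⟩
      simp only [SetLike.mem_coe]
      rcases lt_or_ge i a with h | h
      · have := hamin i h
        rw [qS, if_neg (by omega), mul_zero]; exact zero_mem _
      · obtain ⟨i, rfl⟩ := Nat.exists_eq_add_of_le h
        rcases le_or_gt i N with h | h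
        · exact hin i h
        · rcases le_or_gt (a + i) (S.t S.r) with h3 | h3
          · have h4 : c (a + i) = b :=
              le_antisymm ((hc (by omega)).trans hN) (hc h3)
            have h5 : pS S (a + N) * qS S (c (a + N)) ∣ pS S (a + i) * qS S (c (a + i)) := by
              rw [h4, hNb]
              exact mul_dvd_mul_right (pS_dvd S _ _ (by omega)) _
            exact Ideal.mem_of_dvd _ h5 (hin N le_rfl)
          · rw [pS, if_neg (by omega), zero_mul]; exact zero_mem _
    · rw [Ideal.span_le]
      rintro _ ⟨_, rfl, _, ⟨i, hi, rfl⟩, rfl⟩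
      refine Ideal.subset_span ⟨a + i, ?_⟩
      exact hfac i hi

/-- Theorem 4.6: if {f₀,…,f_r} = A ⊔ B is a partition of the staircase generators with
A and B nonempty (encoded by index sets KA ⊔ KB = {0,…,r}), then
J ⊓ K = ⟨H₁⋯H_a · V₁⋯V_b⟩ * I_Y for some a ≤ t_r, b ≤ s_r and some (possibly empty)
Ferrers configuration Y built on the points {Aᵢ : a < i ≤ t_r} and {Bⱼ : b < j ≤ s_r};
i.e. J ⊓ K is the defining ideal of a union of lines and ACM points. -/
theorem statement10 (S : Staircase) (KA KB : Set ℕ)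
    (hUnion : KA ∪ KB = Set.Iic S.r) (hDisj : Disjoint KA KB)
    (hAne : KA.Nonempty) (hBne : KB.Nonempty) :
    ∃ a b : ℕ, a ≤ S.t S.r ∧ b ≤ S.s S.r ∧
      ∃ Y : Set ((ℂ × ℂ) × (ℂ × ℂ)),
        (Y = ∅ ∨ IsFerrers Y) ∧
        Y ⊆ {P | ∃ i j, a < i ∧ i ≤ S.t S.r ∧ b < j ∧ j ≤ S.s S.r ∧
          P = (S.A i, S.B j)} ∧
        Ideal.span (stairGen S '' KA) ⊓ Ideal.span (stairGen S '' KB) =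
          Ideal.span {(∏ i ∈ Finset.Icc 1 a, Hf (S.A i)) *
              ∏ j ∈ Finset.Icc 1 b, Vf (S.B j)} * IptsSet Y := by
  have hKA : KA ⊆ Set.Iic S.r := hUnion ▸ Set.subset_union_left
  have hKB : KB ⊆ Set.Iic S.r := hUnion ▸ Set.subset_union_right
  rw [span_eq_stair S KA hKA, span_eq_stair S KB hKB,
    stairS_inf S _ _ (hset_anti S KA) (hset_anti S KB)]
  have hle : ∀ K : Set ℕ, K ⊆ Set.Iic S.r → K.Nonempty →
      sInf (hset S K (S.t S.r)) ≤ S.s S.r := by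
    rintro K hK ⟨k, hk⟩
    have h1 : sInf (hset S K (S.t S.r)) ≤ S.s (S.r - k) :=
      Nat.sInf_le (Or.inr ⟨k, hk, mono_upto S.t S.r S.ht k (hK hk), rfl⟩)
    exact h1.trans (mono_upto S.s S.r S.hs _ (by omega))
  exact stair_final S (fun i => max (sInf (hset S KA i)) (sInf (hset S KB i)))
    (fun i j h => max_le_max (hset_anti S KA h) (hset_anti S KB h))
    (max_le (hle KA hKA hAne) (hle KB hKB hBne))
end
end
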